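/- arXiv:2112.10039 — 2 statements merged into one kernel-verified Lean document; each statement's English description precedes it below -/
import Mathlib

section
/- Let F be a class of measurable functions f : ℝ^{d+q} → ℝ with ‖f‖_∞ ≤ B, let 𝒟 be a class of bounded measurable functions D : ℝ^{d+q} → ℝ (discriminators), and let 𝒢 be a class of measurable functions g : ℝ^m × ℝ^d → ℝ^q (generators). Let {(X_i, Y_i, η_i)}_{i=1}^n be an i.i.d. sample from P_X,Y ⊗ P_η restricted so that (X_i, Y_i) ∼ P_{X,Y} and η_i ∼ P_η independently, and let {(X'_i, Y'_i, η'_i)}_{i=1}^n be an independent ghost sample with the same distribution. Let Ĝ ∈ 𝒢 and let Ĝ' ∈ 𝒢 satisfy sup_{D∈𝒟} (1/n) Σ_i [D(X'_i, Ĝ'(η'_i, X'_i)) − D(X'_i, Y'_i)] ≤ inf_{g∈𝒢} sup_{D∈𝒟} (1/n) Σ_i [D(X'_i, g(η'_i, X'_i)) − D(X'_i, Y'_i)]. Then d_F(P_{X,Ĝ}, P_{X,Y}) ≤ 2ℰ₁ + ℰ₂ + ℰ₃ + ℰ₄, where d_F(μ,ν) = sup_{f∈F}(∫ f dμ − ∫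 f dν), ℰ₁ = sup_{f∈F} inf_{D∈𝒟} ‖f − D‖_∞, ℰ₂ = inf_{g∈𝒢} sup_{D∈𝒟} (1/n) Σ_i [D(X'_i, g(η'_i, X'_i)) − D(X'_i, Y'_i)], ℰ₃ = sup_{f∈F} [(1/n) Σ_i f(X'_i, Y'_i) − E f(X, Y)], and ℰ₄ = sup_{f∈F} [E f(X, Ĝ(η, X)) − (1/n) Σ_i f(X'_i, Ĝ'(η'_i, X'_i))], with (X, η) ∼ P_X ⊗ P_η fresh and independent of both samples. -/
open MeasureTheory ProbabilityTheory

/-- An average of real numbers bounded by `K` in absolute value is bounded by `K`; the average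
over an empty index set is `0`. -/
lemma abs_average_le {n : ℕ} {K : ℝ} (hK : 0 ≤ K) {a : Fin n → ℝ} (ha : ∀ i, |a i| ≤ K) :
    |(1 / (n : ℝ)) * ∑ i, a i| ≤ K := by
  rcases Nat.eq_zero_or_pos n with rfl | hn
  · simpa using hK
  · have hn' : (0 : ℝ) < n := by exact_mod_cast hn
    have hsum : |∑ i, a i| ≤ n * K :=
      (Finset.abs_sum_le_sum_abs _ _).trans
        ((Finset.sum_le_sum fun i _ => ha i).trans (by simp))
    rw [abs_mul, abs_of_pos (by positivity), one_div, inv_mul_le_iff₀ hn']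
    exact hsum

/-- The integral of a real function bounded by `B` against a probability measure is bounded
by `B`. -/
lemma abs_integral_le_of_abs_le {Ω : Type*} [MeasurableSpace Ω] (P : Measure Ω)
    [IsProbabilityMeasure P] {h : Ω → ℝ} {B : ℝ} (hh : ∀ ω, |h ω| ≤ B) :
    |∫ ω, h ω ∂P| ≤ B := by
  simpa using norm_integral_le_of_norm_le_const (μ := P) (f := h) (.of_forall hh)

/-- The supremum of `φ` over `s` dominates each value when `φ` is bounded in absolute value
on `s`. -/
lemma le_sSup_image_of_abs_le {α : Type*} {s : Set α} {φ : α → ℝ} {K : ℝ}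
    (hφ : ∀ x ∈ s, |φ x| ≤ K) {x : α} (hx : x ∈ s) : φ x ≤ sSup (φ '' s) :=
  le_csSup ⟨K, by rintro _ ⟨y, hy, rfl⟩; exact (abs_le.1 (hφ y hy)).2⟩ ⟨x, hx, rfl⟩

/-- If `u` and `v` are bounded, `|u z - v z|` is at most the uniform distance of `u` and `v`. -/
lemma abs_sub_le_sSup_range {α : Type*} {u v : α → ℝ} {B C : ℝ} (hu : ∀ z, |u z| ≤ B)
    (hv : ∀ z, |v z| ≤ C) (z : α) : |u z - v z| ≤ sSup (Set.range fun z => |u z - v z|) :=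
  le_csSup ⟨B + C, by
    rintro _ ⟨y, rfl⟩
    exact (abs_sub _ _).trans (add_le_add (hu y) (hv y))⟩ ⟨z, rfl⟩

/-- **Error decomposition lemma.** For an estimated generator `Ĝ` and a ghost-sample minimax
solution `Ĝ'`, the IPM error `d_F(P_{X,Ĝ}, P_{X,Y})` is bounded by
`2ℰ₁ + ℰ₂ + ℰ₃ + ℰ₄`, where `ℰ₁` and `ℰ₂` are approximation errors and `ℰ₃`, `ℰ₄` are
statistical errors computed from the ghost sample. -/
theorem error_decomposition
    (d q m n : ℕ) (B C𝒟 : ℝ)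
    {Ω : Type*} [MeasurableSpace Ω] (P : Measure Ω) [IsProbabilityMeasure P]
    (F : Set ((Fin d → ℝ) × (Fin q → ℝ) → ℝ))
    (𝒟 : Set ((Fin d → ℝ) × (Fin q → ℝ) → ℝ))
    (𝒢 : Set ((Fin m → ℝ) × (Fin d → ℝ) → Fin q → ℝ))
    (hFne : F.Nonempty) (h𝒟ne : 𝒟.Nonempty)
    (hF : ∀ f ∈ F, Measurable f ∧ ∀ z, |f z| ≤ B)
    (h𝒟 : ∀ D ∈ 𝒟, Measurable D ∧ ∀ z, |D z| ≤ C𝒟)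
    (h𝒢 : ∀ g ∈ 𝒢, Measurable g)
    -- fresh variables and their laws
    (X : Ω → Fin d → ℝ) (Y : Ω → Fin q → ℝ) (η : Ω → Fin m → ℝ)
    (hX : Measurable X) (hY : Measurable Y) (hη : Measurable η)
    (hfreshindep : IndepFun (fun ω => (X ω, Y ω)) η P)
    -- the original sample and the ghost sample
    (Xs : Fin n → Ω → Fin d → ℝ) (Ys : Fin n → Ω → Fin q → ℝ) (ηs : Fin n → Ω → Fin m → ℝ)
    (Xs' : Fin n → Ω → Fin d → ℝ) (Ys' : Fin n → Ω → Fin q → ℝ)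
    (ηs' : Fin n → Ω → Fin m → ℝ)
    (hXs : ∀ i, Measurable (Xs i)) (hYs : ∀ i, Measurable (Ys i))
    (hηs : ∀ i, Measurable (ηs i))
    (hXs' : ∀ i, Measurable (Xs' i)) (hYs' : ∀ i, Measurable (Ys' i))
    (hηs' : ∀ i, Measurable (ηs' i))
    -- the `2n` sample points are i.i.d. copies of `((X, Y), η)`
    (hiid : iIndepFun
      (Sum.elim (fun i ω => (Xs i ω, Ys i ω, ηs i ω))
        (fun i ω => (Xs' i ω, Ys' i ω, ηs' i ω)) : Fin n ⊕ Fin n → Ω →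
          (Fin d → ℝ) × (Fin q → ℝ) × (Fin m → ℝ)) P)
    (hlaw : ∀ j : Fin n ⊕ Fin n,
      Measure.map (Sum.elim (fun i ω => (Xs i ω, Ys i ω, ηs i ω))
        (fun i ω => (Xs' i ω, Ys' i ω, ηs' i ω)) j) P
        = Measure.map (fun ω => (X ω, Y ω, η ω)) P)
    -- the fresh variables are independent of the two samples
    (hfresh : IndepFun (fun ω => (X ω, Y ω, η ω))
      (fun ω (j : Fin n ⊕ Fin n) =>
        Sum.elim (fun i ω' => (Xs i ω', Ys i ω', ηs i ω'))
          (fun i ω' => (Xs' i ω', Ys' i ω', ηs' i ω')) j ω) P)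
    -- the estimator and the ghost minimax solution
    (Ghat Ghat' : Ω → (Fin m → ℝ) × (Fin d → ℝ) → Fin q → ℝ)
    (hGhat : ∀ ω, Ghat ω ∈ 𝒢) (hGhat' : ∀ ω, Ghat' ω ∈ 𝒢)
    (hminimax : ∀ ω,
      sSup ((fun D => (1 / (n : ℝ)) * ∑ i,
          (D (Xs' i ω, Ghat' ω (ηs' i ω, Xs' i ω)) - D (Xs' i ω, Ys' i ω))) '' 𝒟)
      ≤ sInf ((fun g => sSup ((fun D => (1 / (n : ℝ)) * ∑ i,
          (D (Xs' i ω, g (ηs' i ω, Xs' i ω)) - D (Xs' i ω, Ys' i ω))) '' 𝒟)) '' 𝒢)) :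
    ∀ ω,
      sSup ((fun f => (∫ ω', f (X ω', Ghat ω (η ω', X ω')) ∂P)
          - ∫ ω', f (X ω', Y ω') ∂P) '' F)
      ≤ 2 * sSup ((fun f =>
            sInf ((fun D => sSup (Set.range fun z => |f z - D z|)) '' 𝒟)) '' F)
        + sInf ((fun g => sSup ((fun D => (1 / (n : ℝ)) * ∑ i,
            (D (Xs' i ω, g (ηs' i ω, Xs' i ω)) - D (Xs' i ω, Ys' i ω))) '' 𝒟)) '' 𝒢)
        + sSup ((fun f => (1 / (n : ℝ)) * (∑ i, f (Xs' i ω, Ys' i ω))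
            - ∫ ω', f (X ω', Y ω') ∂P) '' F)
        + sSup ((fun f => (∫ ω', f (X ω', Ghat ω (η ω', X ω')) ∂P)
            - (1 / (n : ℝ)) * ∑ i, f (Xs' i ω, Ghat' ω (ηs' i ω, Xs' i ω))) '' F) := by
  intro ω
  have hB : 0 ≤ B := by
    obtain ⟨f, hf⟩ := hFne
    exact (abs_nonneg _).trans ((hF f hf).2 0)
  have hC : 0 ≤ C𝒟 := by
    obtain ⟨D, hD⟩ := h𝒟ne
    exact (abs_nonneg _).trans ((h𝒟 D hD).2 0)
  refine csSup_le (hFne.image _) ?_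
  rintro _ ⟨f, hf, rfl⟩
  have hstat₁ := le_sSup_image_of_abs_le (s := F) (K := B + B)
    (φ := fun f => (1 / (n : ℝ)) * (∑ i, f (Xs' i ω, Ys' i ω)) - ∫ ω', f (X ω', Y ω') ∂P)
    (fun f hf => (abs_sub _ _).trans (add_le_add
      (abs_average_le hB fun i => (hF f hf).2 _)
      (abs_integral_le_of_abs_le P fun ω' => (hF f hf).2 _))) hf
  have hstat₂ := le_sSup_image_of_abs_le (s := F) (K := B + B)
    (φ := fun f => (∫ ω', f (X ω', Ghat ω (η ω', X ω')) ∂P)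
      - (1 / (n : ℝ)) * ∑ i, f (Xs' i ω, Ghat' ω (ηs' i ω, Xs' i ω)))
    (fun f hf => (abs_sub _ _).trans (add_le_add
      (abs_integral_le_of_abs_le P fun ω' => (hF f hf).2 _)
      (abs_average_le hB fun i => (hF f hf).2 _))) hf
  have happrox := le_sSup_image_of_abs_le (s := F) (K := B + C𝒟)
    (φ := fun f => sInf ((fun D => sSup (Set.range fun z => |f z - D z|)) '' 𝒟))
    (fun f hf => by
      have hnonneg : ∀ r ∈ (fun D => sSup (Set.range fun z => |f z - D z|)) '' 𝒟, 0 ≤ r := by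
        rintro _ ⟨D, -, rfl⟩
        exact Real.sSup_nonneg (by rintro _ ⟨z, rfl⟩; exact abs_nonneg _)
      rw [abs_of_nonneg (Real.sInf_nonneg hnonneg)]
      obtain ⟨D, hD⟩ := h𝒟ne
      refine (csInf_le ⟨0, hnonneg⟩ ⟨D, hD, rfl⟩).trans (csSup_le (Set.range_nonempty _) ?_)
      rintro _ ⟨z, rfl⟩
      exact (abs_sub _ _).trans (add_le_add ((hF f hf).2 z) ((h𝒟 D hD).2 z))) hf
  have hmin := hminimax ω
  set ε₂ := sInf ((fun g => sSup ((fun D => (1 / (n : ℝ)) * ∑ i,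
    (D (Xs' i ω, g (ηs' i ω, Xs' i ω)) - D (Xs' i ω, Ys' i ω))) '' 𝒟)) '' 𝒢)
  have hinf : ((1 / (n : ℝ)) * (∑ i, f (Xs' i ω, Ghat' ω (ηs' i ω, Xs' i ω)))
      - (1 / (n : ℝ)) * (∑ i, f (Xs' i ω, Ys' i ω)) - ε₂) / 2
      ≤ sInf ((fun D => sSup (Set.range fun z => |f z - D z|)) '' 𝒟) := by
    refine le_csInf (h𝒟ne.image _) ?_
    rintro _ ⟨D, hD, rfl⟩
    have hdist := abs_sub_le_sSup_range (hF f hf).2 (h𝒟 D hD).2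
    have hempirical := le_sSup_image_of_abs_le (s := 𝒟) (K := C𝒟 + C𝒟)
      (φ := fun D => (1 / (n : ℝ)) * ∑ i,
        (D (Xs' i ω, Ghat' ω (ηs' i ω, Xs' i ω)) - D (Xs' i ω, Ys' i ω)))
      (fun D hD => abs_average_le (add_nonneg hC hC) fun i =>
        (abs_sub _ _).trans (add_le_add ((h𝒟 D hD).2 _) ((h𝒟 D hD).2 _))) hD
    beta_reduce at hempirical ⊢
    set r := sSup (Set.range fun z => |f z - D z|)
    have hr : 0 ≤ r := (abs_nonneg _).trans (hdist 0)
    have hf_gen := (abs_le.1 (abs_average_le hr fun i =>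
      hdist (Xs' i ω, Ghat' ω (ηs' i ω, Xs' i ω)))).2
    have hf_data := (abs_le.1 (abs_average_le hr fun i => hdist (Xs' i ω, Ys' i ω))).1
    simp only [Finset.sum_sub_distrib, mul_sub] at hf_gen hf_data hempirical hmin
    linarith
  beta_reduce at hstat₁ hstat₂ happrox ⊢
  linarith
end

section
/- Let (𝒲, 𝒜) be a measurable space, μ a probability measure on 𝒲, and F a class of measurable functions f : 𝒲 → ℝ with sup_{f∈F} ‖f‖_∞ ≤ B. Let W₁, …, W_n, W'₁, …, W'_n be 2n i.i.d. random elements with law μ, and let ε₁, …, ε_n be i.i.d. Rademacher random variables (uniform on {−1, +1}) independent of everything else. Then E[ sup_{f∈F} ( ∫ f dμ − (1/n) Σ_{i=1}^n f(W'_i) ) ] ≤ 2 E[ sup_{f∈F} (1/n) Σ_{i=1}^n ε_i f(W_i) ]. -/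
open MeasureTheory ProbabilityTheory

lemma measurable_sumElim_pi {α β ι ι' : Type*} [MeasurableSpace α] [MeasurableSpace β]
    {v : β → ι → α} {w : β → ι' → α}
    (hv : Measurable v) (hw : Measurable w) : Measurable fun b => Sum.elim (v b) (w b) := by
  refine measurable_pi_lambda _ ?_
  rintro (i | i)
  exacts [(measurable_pi_apply i).comp hv, (measurable_pi_apply i).comp hw]

section WeightedSup

variable {α ι κ : Type*} [Fintype ι]

/-- The supremum over `k` of the weighted sums `∑ i, t i * f k (z i)`. -/
noncomputable def weightedSup (f : κ → α → ℝ) (t : ι → ℝ) (z : ι → α) : ℝ :=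
  ⨆ k, ∑ i, t i * f k (z i)

variable {f : κ → α → ℝ} {B : ℝ}

lemma abs_sum_mul_le_of_abs_le (hfB : ∀ k x, |f k x| ≤ B) (t : ι → ℝ) (z : ι → α) (k : κ) :
    |∑ i, t i * f k (z i)| ≤ ∑ i, |t i| * B := by
  refine (Finset.abs_sum_le_sum_abs _ _).trans (Finset.sum_le_sum fun i _ => ?_)
  rw [abs_mul]
  exact mul_le_mul_of_nonneg_left (hfB k _) (abs_nonneg _)

lemma sum_mul_le_weightedSup (hfB : ∀ k x, |f k x| ≤ B) (t : ι → ℝ) (z : ι → α) (k : κ) :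
    ∑ i, t i * f k (z i) ≤ weightedSup f t z := by
  refine le_ciSup (f := fun k => ∑ i, t i * f k (z i)) ⟨∑ i, |t i| * B, ?_⟩ k
  rintro _ ⟨k, rfl⟩
  exact (abs_le.1 (abs_sum_mul_le_of_abs_le hfB t z k)).2

lemma abs_weightedSup_le [Nonempty κ] (hfB : ∀ k x, |f k x| ≤ B) (t : ι → ℝ) (z : ι → α) :
    |weightedSup f t z| ≤ ∑ i, |t i| * B := by
  have h := abs_sum_mul_le_of_abs_le hfB t z
  inhabit κ
  exact abs_le.2 ⟨(abs_le.1 (h default)).1.trans (sum_mul_le_weightedSup hfB t z default),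
    ciSup_le fun k => (abs_le.1 (h k)).2⟩

lemma weightedSup_comp_equiv (f : κ → α → ℝ) (t : ι → ℝ) (z : ι → α) (e : ι ≃ ι) :
    weightedSup f (t ∘ e) (z ∘ e) = weightedSup f t z :=
  iSup_congr fun k => e.sum_comp fun i => t i * f k (z i)

lemma weightedSup_sumElim_le {ι' : Type*} [Fintype ι'] [Nonempty κ] (hfB : ∀ k x, |f k x| ≤ B)
    (t : ι → ℝ) (t' : ι' → ℝ) (z : ι → α) (z' : ι' → α) :
    weightedSup f (Sum.elim t t') (Sum.elim z z') ≤ weightedSup f t z + weightedSup f t' z' := by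
  refine ciSup_le fun k => ?_
  simpa using add_le_add (sum_mul_le_weightedSup hfB t z k) (sum_mul_le_weightedSup hfB t' z' k)

variable [MeasurableSpace α]

lemma integral_pi_sum (μ : Measure α) [SigmaFinite μ] {ι' : Type*} [Fintype ι']
    (g : (ι ⊕ ι' → α) → ℝ) :
    ∫ z, g z ∂Measure.pi (fun _ : ι ⊕ ι' => μ) = ∫ p : (ι → α) × (ι' → α),
      g (Sum.elim p.1 p.2) ∂(Measure.pi fun _ : ι => μ).prod (Measure.pi fun _ : ι' => μ) := by
  have hmp := measurePreserving_sumPiEquivProdPi_symm (fun _ : ι ⊕ ι' => μ)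
  rw [← hmp.integral_comp (MeasurableEquiv.measurableEmbedding _)]
  refine integral_congr_ae (.of_forall fun p => congrArg g ?_)
  ext j
  cases j <;> rfl

lemma integral_weightedSup_comp_equiv (μ : Measure α) [SigmaFinite μ] (f : κ → α → ℝ)
    (t : ι → ℝ) (e : ι ≃ ι) :
    ∫ z, weightedSup f (t ∘ e) z ∂Measure.pi (fun _ : ι => μ)
      = ∫ z, weightedSup f t z ∂Measure.pi (fun _ : ι => μ) := by
  have h := measurePreserving_piCongrLeft (fun _ : ι => μ) e
  rw [← h.integral_comp (MeasurableEquiv.measurableEmbedding _) (weightedSup f t)]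
  refine integral_congr_ae (.of_forall fun z => Eq.trans ?_ (weightedSup_comp_equiv f t _ e))
  refine congrArg (weightedSup f (t ∘ e)) (funext fun i => ?_)
  exact (Equiv.piCongrLeft_apply_apply (fun _ : ι => α) e z i).symm

/-- Exchanging the two halves of a doubled sample in the coordinates where `s i = -1`. -/
lemma integral_weightedSup_sign (μ : Measure α) [SigmaFinite μ] (f : κ → α → ℝ) {s : ι → ℝ}
    (hs : ∀ i, s i = -1 ∨ s i = 1) :
    ∫ z, weightedSup f (Sum.elim s (-s)) z ∂Measure.pi (fun _ : ι ⊕ ι => μ)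
      = ∫ z, weightedSup f (Sum.elim 1 (-1)) z ∂Measure.pi (fun _ : ι ⊕ ι => μ) := by
  let σ : ι ⊕ ι → ι ⊕ ι := Sum.elim (fun i => if s i = 1 then .inl i else .inr i)
    (fun i => if s i = 1 then .inr i else .inl i)
  have hσ : Function.Involutive σ := by
    rintro (i | i) <;> by_cases h : s i = 1 <;> simp [σ, h]
  rw [← integral_weightedSup_comp_equiv μ f _ hσ.toPerm]
  congr! 3
  ext j
  rcases j with i | i <;> rcases hs i with h | h <;> norm_num [σ, h]

variable [Countable κ]

lemma Measurable.weightedSup {β : Type*} [MeasurableSpace β] (hfm : ∀ k, Measurable (f k))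
    {t : β → ι → ℝ} {z : β → ι → α} (ht : Measurable t) (hz : Measurable z) :
    Measurable fun b => weightedSup f (t b) (z b) := by
  refine Measurable.iSup fun k => Finset.measurable_fun_sum _ fun i _ => ?_
  exact ((measurable_pi_apply i).comp ht).mul ((hfm k).comp ((measurable_pi_apply i).comp hz))

variable [Nonempty κ]

lemma integrable_weightedSup (hfm : ∀ k, Measurable (f k)) (hfB : ∀ k x, |f k x| ≤ B)
    {β : Type*} [MeasurableSpace β] (m : Measure β) [IsFiniteMeasure m] (t : ι → ℝ)
    {z : β → ι → α} (hz : Measurable z) :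
    Integrable (fun b => weightedSup f t (z b)) m :=
  .of_bound (Measurable.weightedSup hfm measurable_const hz).aestronglyMeasurable
    (∑ i, |t i| * B) (.of_forall fun b => abs_weightedSup_le hfB t (z b))

/-- A ghost sample turns centred sums into differences of two independent samples. -/
lemma integral_weightedSup_centred_le (μ : Measure α) [IsProbabilityMeasure μ]
    (hfm : ∀ k, Measurable (f k)) (hfB : ∀ k x, |f k x| ≤ B) :
    ∫ w, weightedSup (fun k x => (∫ y, f k y ∂μ) - f k x) 1 w ∂Measure.pi (fun _ : ι => μ)
      ≤ ∫ z, weightedSup f (Sum.elim 1 (-1)) z ∂Measure.pi (fun _ : ι ⊕ ι => μ) := by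
  have hfi (k : κ) : Integrable (f k) μ :=
    .of_bound (hfm k).aestronglyMeasurable B (.of_forall (hfB k))
  have hpair : Integrable (fun p : (ι → α) × (ι → α) =>
      weightedSup f (Sum.elim 1 (-1)) (Sum.elim p.1 p.2))
      ((Measure.pi fun _ : ι => μ).prod (Measure.pi fun _ : ι => μ)) :=
    integrable_weightedSup hfm hfB _ _ (measurable_sumElim_pi measurable_fst measurable_snd)
  rw [integral_pi_sum, integral_prod_symm _ hpair]
  have hcB (k : κ) (x : α) : |(∫ y, f k y ∂μ) - f k x| ≤ B + B := by
    refine (abs_sub _ _).trans (add_le_add ?_ (hfB k x))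
    simpa using norm_integral_le_of_norm_le_const (μ := μ) (f := f k) (C := B)
      (.of_forall (hfB k))
  refine integral_mono (integrable_weightedSup (fun k => (hfm k).const_sub _) hcB _ _
    measurable_id) hpair.integral_prod_right fun w => ciSup_le fun k => ?_
  have hcoord (i : ι) : Integrable (fun v : ι → α => f k (v i)) (Measure.pi fun _ : ι => μ) :=
    (measurePreserving_eval (fun _ : ι => μ) i).integrable_comp_of_integrable (hfi k)
  calc ∑ i, (1 : ι → ℝ) i * ((∫ y, f k y ∂μ) - f k (w i))
      = ∫ v, ∑ i, (f k (v i) - f k (w i)) ∂Measure.pi (fun _ : ι => μ) := by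
        rw [integral_finsetSum _ fun i _ => (hcoord i).sub' (integrable_const (f k (w i)))]
        refine Finset.sum_congr rfl fun i _ => ?_
        rw [integral_sub (hcoord i) (integrable_const _),
          integral_comp_eval (μ := fun _ : ι => μ) (hfm k).aestronglyMeasurable]
        simp
    _ ≤ _ := by
        refine integral_mono (integrable_finsetSum _ fun i _ => (hcoord i).sub
          (integrable_const _)) (integrable_weightedSup hfm hfB _ _
          (measurable_sumElim_pi measurable_id measurable_const)) fun v => ?_
        simpa [sub_eq_add_neg, Finset.sum_add_distrib] using
          sum_mul_le_weightedSup hfB (Sum.elim 1 (-1)) (Sum.elim v w) k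

lemma integral_weightedSup_sumElim_le (μ : Measure α) [IsProbabilityMeasure μ]
    (hfm : ∀ k, Measurable (f k)) (hfB : ∀ k x, |f k x| ≤ B) (s t : ι → ℝ) :
    ∫ z, weightedSup f (Sum.elim s t) z ∂Measure.pi (fun _ : ι ⊕ ι => μ)
      ≤ (∫ v, weightedSup f s v ∂Measure.pi (fun _ : ι => μ))
        + ∫ v, weightedSup f t v ∂Measure.pi (fun _ : ι => μ) := by
  have hs := integrable_weightedSup hfm hfB (Measure.pi fun _ : ι => μ) s measurable_id
  have ht := integrable_weightedSup hfm hfB (Measure.pi fun _ : ι => μ) t measurable_id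
  have hs' := hs.comp_fst (Measure.pi fun _ : ι => μ)
  have ht' := ht.comp_snd (Measure.pi fun _ : ι => μ)
  rw [integral_pi_sum]
  refine (integral_mono (integrable_weightedSup hfm hfB _ _
    (measurable_sumElim_pi measurable_fst measurable_snd)) (hs'.add ht')
    fun p => weightedSup_sumElim_le hfB s t p.1 p.2).trans_eq ?_
  rw [integral_add' hs' ht']
  simp [integral_fun_fst, integral_fun_snd]

/-- Symmetrization for the unnormalised sums, in terms of the laws of the sample and of the signs. -/
lemma integral_weightedSup_centred_le_two_mul (μ : Measure α) [IsProbabilityMeasure μ]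
    (hfm : ∀ k, Measurable (f k)) (hfB : ∀ k x, |f k x| ≤ B)
    (ρ : Measure (ι → ℝ)) [IsProbabilityMeasure ρ] [ρ.IsNegInvariant]
    (hρ : ∀ᵐ s ∂ρ, ∀ i, s i = -1 ∨ s i = 1) :
    ∫ w, weightedSup (fun k x => (∫ y, f k y ∂μ) - f k x) 1 w ∂Measure.pi (fun _ : ι => μ)
      ≤ 2 * ∫ p : (ι → ℝ) × (ι → α), weightedSup f p.1 p.2
          ∂ρ.prod (Measure.pi fun _ : ι => μ) := by
  set ν := Measure.pi fun _ : ι => μ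
  have hsup : Integrable (fun p : (ι → ℝ) × (ι → α) => weightedSup f p.1 p.2) (ρ.prod ν) := by
    refine .of_bound (Measurable.weightedSup hfm measurable_fst
      measurable_snd).aestronglyMeasurable (∑ _i : ι, 1 * B) ?_
    filter_upwards [Measure.quasiMeasurePreserving_fst.ae hρ] with p hp
    refine (abs_weightedSup_le hfB p.1 p.2).trans_eq (Finset.sum_congr rfl fun i _ => ?_)
    rcases hp i with h | h <;> simp [h]
  rw [integral_prod _ hsup]
  set φ : (ι → ℝ) → ℝ := fun s => ∫ v, weightedSup f s v ∂ν
  have hφ : Integrable φ ρ := hsup.integral_prod_left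
  have hneg : MeasurePreserving Neg.neg ρ ρ := Measure.measurePreserving_neg ρ
  have hφneg : Integrable (fun s => φ (-s)) ρ := hneg.integrable_comp_of_integrable hφ
  have hle : ∀ᵐ s ∂ρ, ∫ w, weightedSup (fun k x => (∫ y, f k y ∂μ) - f k x) 1 w ∂ν
      ≤ φ s + φ (-s) := by
    filter_upwards [hρ] with s hs
    refine (integral_weightedSup_centred_le μ hfm hfB).trans ?_
    rw [← integral_weightedSup_sign μ f hs]
    exact integral_weightedSup_sumElim_le μ hfm hfB s (-s)
  have h := integral_mono_ae (integrable_const _) (hφ.add hφneg) hle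
  rw [integral_add' hφ hφneg, integral_neg_eq_self φ ρ] at h
  simpa [two_mul] using h

end WeightedSup

lemma isNegInvariant_rademacher : ((1 / 2 : ENNReal) • Measure.dirac (-1 : ℝ)
    + (1 / 2 : ENNReal) • Measure.dirac 1).IsNegInvariant := by
  constructor
  rw [Measure.neg, Measure.map_add _ _ measurable_neg, Measure.map_smul, Measure.map_smul,
    Measure.map_dirac' measurable_neg, Measure.map_dirac' measurable_neg, neg_neg, add_comm]

/-- **Symmetrization.** For a uniformly bounded (countable) class `F` of measurable
functions, `2n` i.i.d. variables `W₁, …, W_n, W'₁, …, W'_n` with law `μ`, and independent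
Rademacher variables `ε₁, …, ε_n`, we have
`E[sup_{f∈F} (∫ f dμ − (1/n)Σᵢ f(W'ᵢ))] ≤ 2 E[sup_{f∈F} (1/n)Σᵢ εᵢ f(Wᵢ)]`. -/
theorem symmetrization
    (n : ℕ) (hn : 1 ≤ n) (B : ℝ)
    {𝒲 : Type*} [MeasurableSpace 𝒲] (μ : Measure 𝒲) [IsProbabilityMeasure μ]
    {Ω : Type*} [MeasurableSpace Ω] (P : Measure Ω) [IsProbabilityMeasure P]
    (F : Set (𝒲 → ℝ)) (hFc : F.Countable) (hFne : F.Nonempty)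
    (hF : ∀ f ∈ F, Measurable f ∧ ∀ x, |f x| ≤ B)
    (W W' : Fin n → Ω → 𝒲) (ε : Fin n → Ω → ℝ)
    (hWm : ∀ i, Measurable (W i)) (hW'm : ∀ i, Measurable (W' i))
    (hεm : ∀ i, Measurable (ε i))
    -- the 2n sample points are i.i.d. with law μ
    (hiid : iIndepFun (Sum.elim W W') P)
    (hlaw : ∀ j : Fin n ⊕ Fin n, Measure.map (Sum.elim W W' j) P = μ)
    -- the εᵢ are i.i.d. Rademacher variables
    (hεiid : iIndepFun ε P)
    (hεlaw : ∀ i, Measure.map (ε i) P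
      = (1 / 2 : ENNReal) • Measure.dirac (-1 : ℝ) + (1 / 2 : ENNReal) • Measure.dirac 1)
    -- the εᵢ are independent of everything else
    (hindep : IndepFun (fun ω (i : Fin n) => ε i ω)
      (fun ω (j : Fin n ⊕ Fin n) => Sum.elim W W' j ω) P) :
    (∫ ω, sSup ((fun f => (∫ x, f x ∂μ) - (1 / (n : ℝ)) * ∑ i, f (W' i ω)) '' F) ∂P)
      ≤ 2 * ∫ ω, sSup ((fun f => (1 / (n : ℝ)) * ∑ i, ε i ω * f (W i ω)) '' F) ∂P := by
  have : Nonempty F := hFne.to_subtype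
  have : Countable F := hFc.to_subtype
  have hfm : ∀ k : F, Measurable (k : 𝒲 → ℝ) := fun k => (hF k k.2).1
  have hfB : ∀ (k : F) (x : 𝒲), |(k : 𝒲 → ℝ) x| ≤ B := fun k => (hF k k.2).2
  have hn0 : (n : ℝ) ≠ 0 := by positivity
  have hc : (0 : ℝ) ≤ 1 / n := by positivity
  set f : F → 𝒲 → ℝ := fun k => k
  set g : F → 𝒲 → ℝ := fun k x => (∫ y, f k y ∂μ) - f k x
  have hWpi : P.map (fun ω i => W i ω) = Measure.pi fun _ => μ :=
    ((hiid.precomp Sum.inl_injective).map_fun_eq_pi_map fun i => (hWm i).aemeasurable).trans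
      (congrArg _ (funext fun i => hlaw (.inl i)))
  have hW'pi : P.map (fun ω i => W' i ω) = Measure.pi fun _ => μ :=
    ((hiid.precomp Sum.inr_injective).map_fun_eq_pi_map fun i => (hW'm i).aemeasurable).trans
      (congrArg _ (funext fun i => hlaw (.inr i)))
  have hWmeas : Measurable fun ω i => W i ω := measurable_pi_lambda _ hWm
  have hW'meas : Measurable fun ω i => W' i ω := measurable_pi_lambda _ hW'm
  have hεmeas : Measurable fun ω i => ε i ω := measurable_pi_lambda _ hεm
  have hjoint : P.map (fun ω => ((fun i => ε i ω), fun i => W i ω))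
      = (P.map fun ω i => ε i ω).prod (Measure.pi fun _ => μ) := by
    rw [← hWpi]
    refine (indepFun_iff_map_prod_eq_prod_map_map hεmeas.aemeasurable hWmeas.aemeasurable).1 ?_
    exact hindep.comp measurable_id (ψ := fun z i => z (.inl i)) (by fun_prop)
  have : IsProbabilityMeasure (P.map fun ω i => ε i ω) :=
    Measure.isProbabilityMeasure_map hεmeas.aemeasurable
  have : (P.map fun ω i => ε i ω).IsNegInvariant := by
    have (i : Fin n) : IsProbabilityMeasure (P.map (ε i)) :=
      Measure.isProbabilityMeasure_map (hεm i).aemeasurable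
    have (i : Fin n) : (P.map (ε i)).IsNegInvariant := hεlaw i ▸ isNegInvariant_rademacher
    rw [hεiid.map_fun_eq_pi_map fun i => (hεm i).aemeasurable]
    infer_instance
  have hsign : ∀ᵐ s ∂P.map fun ω i => ε i ω, ∀ i, s i = -1 ∨ s i = 1 := by
    refine ae_all_iff.2 fun i => ?_
    have hi : ∀ᵐ x ∂P.map (ε i), x = -1 ∨ x = 1 := by
      rw [hεlaw i, ae_add_measure_iff]
      exact ⟨Measure.ae_smul_measure (by simp [ae_dirac_eq]) _,
        Measure.ae_smul_measure (by simp [ae_dirac_eq]) _⟩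
    have hset : MeasurableSet {x : ℝ | x = -1 ∨ x = 1} :=
      (measurableSet_singleton (-1)).union (measurableSet_singleton 1)
    refine (ae_map_iff hεmeas.aemeasurable (measurable_pi_apply i hset)).2 ?_
    exact ae_of_ae_map (hεm i).aemeasurable hi
  have hleft (ω : Ω) : sSup ((fun f => (∫ x, f x ∂μ) - (1 / (n : ℝ)) * ∑ i, f (W' i ω)) '' F)
      = 1 / n * weightedSup g 1 (fun i => W' i ω) := by
    rw [sSup_image', weightedSup, Real.mul_iSup_of_nonneg hc]
    refine iSup_congr fun k => ?_
    simp [g, f, mul_sub, hn0]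
  have hright (ω : Ω) : sSup ((fun f => (1 / (n : ℝ)) * ∑ i, ε i ω * f (W i ω)) '' F)
      = 1 / n * weightedSup f (fun i => ε i ω) (fun i => W i ω) := by
    rw [sSup_image', weightedSup, Real.mul_iSup_of_nonneg hc]
  simp_rw [hleft, hright, integral_const_mul]
  rw [mul_left_comm]
  refine mul_le_mul_of_nonneg_left ?_ hc
  have hgm : Measurable fun w : Fin n → 𝒲 => weightedSup g 1 w :=
    Measurable.weightedSup (fun k => (hfm k).const_sub _) measurable_const measurable_id
  have hfm' : Measurable fun p : (Fin n → ℝ) × (Fin n → 𝒲) => weightedSup f p.1 p.2 :=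
    Measurable.weightedSup hfm measurable_fst measurable_snd
  rw [← integral_map hW'meas.aemeasurable hgm.aestronglyMeasurable,
    ← integral_map (hεmeas.prodMk hWmeas).aemeasurable hfm'.aestronglyMeasurable, hjoint, hW'pi]
  exact integral_weightedSup_centred_le_two_mul μ hfm hfB _ hsign
end
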